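/- arXiv:1401.5166 — 2 statements merged into one kernel-verified Lean document; each statement's English description precedes it below -/
import Mathlib

section
/- Let p>1, δ>1, Q≥2, and let s^- := u^-(1/ε) with ε = ε(p,δ,Q). Let q ∈ (1/s^-, 0). Let J be a dyadic interval and let w be a weight with w ∈ RH_p^{δ,d}(J) and Db^d(w) ≤ Q. Set x := ⟨w⟩_J, y := ⟨w^p⟩_J and r^- := u^-(y^{1/p}/(εx)). Then ⟨w^q⟩_J ≤ x^q · (1−q·r^-)/(1−q·s^-) · ((1−s^-)/(1−r^-))^q. -/
open MeasureTheory Set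

/-- The dyadic interval `[n·2^(-k), (n+1)·2^(-k)]`. -/
noncomputable def dIcc (n k : ℕ) : Set ℝ :=
  Set.Icc ((n : ℝ) * 2 ^ (-(k : ℤ))) (((n : ℝ) + 1) * 2 ^ (-(k : ℤ)))

/-- The average `⟨f⟩_I` of `f` over the dyadic interval `I = [n·2^(-k), (n+1)·2^(-k)]`
(whose length is `2^(-k)`). -/
noncomputable def avg (f : ℝ → ℝ) (n k : ℕ) : ℝ :=
  (2 : ℝ) ^ (k : ℤ) * ∫ x in dIcc n k, f x


/-- tangent line at `v` to the power function `z ↦ z^a`, evaluated at `x`. -/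
noncomputable def gg (a v x : ℝ) : ℝ := (1 - a) * v ^ a + a * v ^ (a - 1) * x

lemma gg_hasDerivAt (a x : ℝ) {v : ℝ} (hv : 0 < v) :
    HasDerivAt (fun v => gg a v x) (a * (a - 1) * v ^ (a - 2) * (x - v)) v := by
  unfold gg
  have h1 := (Real.hasDerivAt_rpow_const (p := a) (Or.inl hv.ne')).const_mul (1 - a)
  have h2 := ((Real.hasDerivAt_rpow_const (p := a - 1) (Or.inl hv.ne')).const_mul a).mul_const x
  refine (h1.add h2).congr_deriv ?_
  have e1 : v ^ (a - 1) = v ^ (a - 2) * v := by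
    rw [← Real.rpow_add_one hv.ne']; ring_nf
  have e2 : v ^ (a - 1 - 1) = v ^ (a - 2) := by ring_nf
  rw [e2, e1]; ring

lemma gg_strictMonoOn {a : ℝ} (ha : 0 < a * (a - 1)) (x : ℝ) :
    StrictMonoOn (fun v => gg a v x) (Ioc 0 x) := by
  apply strictMonoOn_of_deriv_pos (convex_Ioc 0 x)
  · intro v hv
    exact (gg_hasDerivAt a x hv.1).continuousAt.continuousWithinAt
  · intro v hv
    rw [interior_Ioc] at hv
    rw [(gg_hasDerivAt a x hv.1).deriv]
    have := Real.rpow_pos_of_pos hv.1 (a - 2)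
    have h2 : 0 < x - v := by linarith [hv.2]
    positivity

lemma gg_antitoneOn {a : ℝ} (ha : 0 < a * (a - 1)) {x : ℝ} (hx : 0 < x) :
    AntitoneOn (fun v => gg a v x) (Ici x) := by
  apply antitoneOn_of_deriv_nonpos (convex_Ici x)
  · intro v hv
    exact (gg_hasDerivAt a x (hx.trans_le hv)).continuousAt.continuousWithinAt
  · intro v hv
    rw [interior_Ici] at hv
    exact (gg_hasDerivAt a x (hx.trans hv)).differentiableAt.differentiableWithinAt
  · intro v hv
    rw [interior_Ici] at hv
    have hv0 : 0 < v := hx.trans hv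
    rw [(gg_hasDerivAt a x hv0).deriv]
    have := Real.rpow_pos_of_pos hv0 (a - 2)
    have h2 : x - v ≤ 0 := by linarith [mem_Ioi.1 hv]
    exact mul_nonpos_of_nonneg_of_nonpos (by positivity) h2

lemma LL_hasDerivAt (p q κ η x : ℝ) (hκ : κ * (p * (p - 1)) = q * (q - 1)) {v : ℝ} (hv : 0 < v) :
    HasDerivAt (fun v => gg q v x + κ * v ^ (q - p) * (η - gg p v x))
      (κ * (q - p) * v ^ (q - p - 1) * (η - gg p v x)) v := by
  have h1 := gg_hasDerivAt q x hv
  have h2 := (gg_hasDerivAt p x hv).const_sub η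
  have h3 := (Real.hasDerivAt_rpow_const (p := q - p) (Or.inl hv.ne')).const_mul κ
  refine (h1.add (h3.mul h2)).congr_deriv ?_
  have e1 : v ^ (q - 2) = v ^ (q - p) * v ^ (p - 2) := by
    rw [← Real.rpow_add hv]; ring_nf
  rw [e1, ← hκ]; ring

/-- The affine functions `L_u` majorize the Bellman function. -/
lemma LL_le {p q κ η x u₁ u : ℝ} (hp : 1 < p) (hq : q < 0)
    (hκ : κ * (p * (p - 1)) = q * (q - 1)) (hu₁ : 0 < u₁) (hu₁x : u₁ ≤ x)
    (hη : gg p u₁ x = η) (hu : 0 < u) (h : x < u → η ≤ gg p u x) :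
    gg q u₁ x ≤ gg q u x + κ * u ^ (q - p) * (η - gg p u x) := by
  have hpp : 0 < p * (p - 1) := mul_pos (by linarith) (by linarith)
  have hκ0 : 0 < κ := by
    have : 0 < q * (q - 1) := mul_pos_of_neg_of_neg hq (by linarith)
    rw [← hκ] at this
    exact pos_of_mul_pos_left this hpp.le
  have hx : 0 < x := hu₁.trans_le hu₁x
  set f := fun v => gg q v x + κ * v ^ (q - p) * (η - gg p v x) with hf
  have hfu : f u₁ = gg q u₁ x := by simp [hf, hη]
  suffices f u₁ ≤ f u by rw [hfu] at this; exact this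
  have hneg : ∀ v, 0 < v → κ * (q - p) * v ^ (q - p - 1) ≤ 0 := by
    intro v hv
    have := Real.rpow_pos_of_pos hv (q - p - 1)
    exact mul_nonpos_of_nonpos_of_nonneg
      (mul_nonpos_of_nonneg_of_nonpos hκ0.le (by linarith)) this.le
  have hder : ∀ v, 0 < v → HasDerivAt f (κ * (q - p) * v ^ (q - p - 1) * (η - gg p v x)) v :=
    fun v hv => LL_hasDerivAt p q κ η x hκ hv
  rcases le_total u u₁ with hle | hle
  · have : AntitoneOn f (Icc u u₁) := by
      apply antitoneOn_of_deriv_nonpos (convex_Icc _ _)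
      · intro v hv
        exact (hder v (hu.trans_le hv.1)).continuousAt.continuousWithinAt
      · intro v hv
        rw [interior_Icc] at hv
        exact (hder v (hu.trans hv.1)).differentiableAt.differentiableWithinAt
      · intro v hv
        rw [interior_Icc] at hv
        have hv0 := hu.trans hv.1
        rw [(hder v hv0).deriv]
        have : gg p v x ≤ gg p u₁ x := (gg_strictMonoOn hpp x).monotoneOn
          ⟨hv0, hv.2.le.trans hu₁x⟩ ⟨hu₁, hu₁x⟩ hv.2.le
        exact mul_nonpos_of_nonpos_of_nonneg (hneg v hv0) (by linarith)
    exact this ⟨le_rfl, hle⟩ ⟨hle, le_rfl⟩ hle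
  · have : MonotoneOn f (Icc u₁ u) := by
      apply monotoneOn_of_deriv_nonneg (convex_Icc _ _)
      · intro v hv
        exact (hder v (hu₁.trans_le hv.1)).continuousAt.continuousWithinAt
      · intro v hv
        rw [interior_Icc] at hv
        exact (hder v (hu₁.trans hv.1)).differentiableAt.differentiableWithinAt
      · intro v hv
        rw [interior_Icc] at hv
        have hv0 := hu₁.trans hv.1
        rw [(hder v hv0).deriv]
        have : η ≤ gg p v x := by
          rcases le_or_gt v x with hvx | hvx
          · have : gg p u₁ x ≤ gg p v x := (gg_strictMonoOn hpp x).monotoneOn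
              ⟨hu₁, hu₁x⟩ ⟨hv0, hvx⟩ hv.1.le
            linarith
          · exact (h (hvx.trans hv.2)).trans
              (gg_antitoneOn hpp hx hvx.le (hvx.trans hv.2).le hv.2.le)
        exact mul_nonneg_of_nonpos_of_nonpos (hneg v hv0) (by linarith)
    exact this ⟨le_rfl, hle⟩ ⟨hle, le_rfl⟩ hle

/-- Existence of the tangency parameter. -/
lemma exists_u {p η x : ℝ} (hp : 1 < p) (hx : 0 < x) (hη : 0 < η) (hηx : η ≤ x ^ p) :
    ∃ u, 0 < u ∧ u ≤ x ∧ gg p u x = η := by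
  have hc : ContinuousOn (fun v => gg p v x) (Icc 0 x) := by
    unfold gg
    have h1 : Continuous fun v : ℝ => v ^ p := Real.continuous_rpow_const (by linarith)
    have h2 : Continuous fun v : ℝ => v ^ (p - 1) := Real.continuous_rpow_const (by linarith)
    fun_prop
  have h0 : gg p 0 x = 0 := by
    simp [gg, Real.zero_rpow (by linarith : p ≠ 0), Real.zero_rpow (by linarith : p - 1 ≠ 0)]
  have h1 : gg p x x = x ^ p := by
    unfold gg
    have : x ^ p = x ^ (p - 1) * x := by rw [← Real.rpow_add_one hx.ne']; ring_nf
    rw [this]; ring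
  have := intermediate_value_Icc hx.le hc
  simp only [h0, h1] at this
  obtain ⟨u, hu, hu'⟩ := this ⟨hη.le, hηx⟩
  refine ⟨u, lt_of_le_of_ne hu.1 ?_, hu.2, hu'⟩
  rintro rfl
  simp only [h0] at hu'
  linarith

/-- The geometric facts on `ε`. -/
lemma eps_facts {p δ Q H ε : ℝ} (hp : 1 < p) (hδ : 1 < δ) (hQ : 2 ≤ Q)
    (hH : H = (Q ^ p - 1) / (Q - 1))
    (hε : ε = H / p * ((p - 1) / (H - 1)) ^ ((p - 1) / p) * δ) :
    δ < ε ∧ ∀ z, 0 < z → δ ^ p * (1 + H * (z - 1)) ≤ ε ^ p * z ^ p := by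
  have hp0 : 0 < p := by linarith
  have hHp : p < H := by
    have := one_add_mul_self_lt_rpow_one_add (s := Q - 1) (by linarith) (by linarith) hp
    rw [hH, lt_div_iff₀ (by linarith)]
    have e : 1 + (Q - 1) = Q := by ring
    rw [e] at this
    linarith
  have ha : 0 < (p - 1) / (H - 1) := div_pos (by linarith) (by linarith)
  have hH0 : 0 < H := by linarith
  have hδ0 : 0 < δ := by linarith
  constructor
  · set b := (p - 1) / (H - 1) with hb
    -- (1/b)^θ < 1 + θ (1/b - 1) = H/p
    have h1 : 1 < 1 / b := by
      rw [hb, one_div_div, lt_div_iff₀ (by linarith)]; linarith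
    have := rpow_one_add_lt_one_add_mul_self (s := 1 / b - 1) (p := (p - 1) / p)
      (by linarith) (by linarith) (by apply div_pos <;> linarith)
      (by rw [div_lt_one hp0]; linarith)
    have e : 1 + (1 / b - 1) = 1 / b := by ring
    have e2 : 1 + (p - 1) / p * (1 / b - 1) = H / p := by
      rw [hb]
      have : p - 1 ≠ 0 := by linarith
      have : H - 1 ≠ 0 := by linarith
      field_simp; ring
    rw [e, e2, one_div, Real.inv_rpow ha.le] at this
    have hbp := Real.rpow_pos_of_pos ha ((p - 1) / p)
    rw [inv_lt_iff_one_lt_mul₀ hbp] at this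
    rw [hε]
    nlinarith
  · intro z hz
    set b := (p - 1) / (H - 1) with hb
    -- z0 = p / (H b)
    have hbern := one_add_mul_self_le_rpow_one_add (s := z * H * b / p - 1) (p := p)
      (by have : 0 < z * H * b / p := by positivity
          linarith) hp.le
    have e : 1 + (z * H * b / p - 1) = z * H * b / p := by ring
    rw [e] at hbern
    have e3 : ε ^ p * z ^ p = δ ^ p * ((z * H * b / p) ^ p / b) := by
      have hb1 : (b ^ ((p - 1) / p)) ^ p = b ^ p / b := by
        rw [← Real.rpow_mul ha.le, div_mul_cancel₀ _ hp0.ne', Real.rpow_sub_one ha.ne']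
      have hbp := Real.rpow_pos_of_pos ha ((p - 1) / p)
      rw [hε, Real.mul_rpow (by positivity) hδ0.le, Real.mul_rpow (by positivity) hbp.le, hb1,
        show z * H * b / p = (H / p) * b * z by ring, Real.mul_rpow (by positivity) hz.le,
        Real.mul_rpow (by positivity) ha.le]
      ring
    rw [e3]
    apply mul_le_mul_of_nonneg_left _ (by positivity)
    rw [le_div_iff₀ ha]
    refine le_trans (le_of_eq ?_) hbern
    rw [hb]
    have : H - 1 ≠ 0 := by linarith
    field_simp; ring

/-- Comparison of a child's Bellman value with the affine majorant at the parent. -/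
lemma child_le {p δ Q H ε q κ x η x₁ η₁ u u₁ : ℝ} (hp : 1 < p) (hδ : 1 < δ) (hQ : 2 ≤ Q)
    (hH : H = (Q ^ p - 1) / (Q - 1))
    (hε : ε = H / p * ((p - 1) / (H - 1)) ^ ((p - 1) / p) * δ) (hq : q < 0)
    (hκ : κ * (p * (p - 1)) = q * (q - 1))
    (hu : 0 < u) (hux : u ≤ x) (hg : gg p u x = η) (hη : ε ^ p * η ≤ δ ^ p * x ^ p)
    (hu₁ : 0 < u₁) (hux₁ : u₁ ≤ x₁) (hg₁ : gg p u₁ x₁ = η₁) (hη₁ : ε ^ p * η₁ ≤ δ ^ p * x₁ ^ p)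
    (hQx : x ≤ Q * x₁) :
    gg q u₁ x₁ ≤ gg q u x₁ + κ * u ^ (q - p) * (η₁ - gg p u x₁) := by
  obtain ⟨hδε, htan⟩ := eps_facts hp hδ hQ hH hε
  refine LL_le hp hq hκ hu₁ hux₁ hg₁ hu fun hlt => ?_
  have hx₁ : 0 < x₁ := hu₁.trans_le hux₁
  have hx : 0 < x := hu.trans_le hux
  have hp0 : 0 < p := by linarith
  have hε0 : 0 < ε := by linarith
  have hεp : 0 < ε ^ p := Real.rpow_pos_of_pos hε0 p
  have hδp : 0 < δ ^ p := Real.rpow_pos_of_pos (by linarith) p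
  have hup : u ^ p = u ^ (p - 1) * u := by rw [← Real.rpow_add_one hu.ne']; ring_nf
  have hux' : u < x := by
    refine lt_of_le_of_ne hux ?_
    rintro rfl
    have : η = u ^ p := by rw [← hg, gg, hup]; ring
    rw [this] at hη
    have h2 := Real.rpow_lt_rpow (by linarith) hδε hp0
    have h3 := Real.rpow_pos_of_pos hu p
    nlinarith
  -- chord bound at x
  have hx1p : 0 < x₁ ^ p := Real.rpow_pos_of_pos hx₁ p
  have hchord : x ^ p ≤ x₁ ^ p * (1 + H * (x / x₁ - 1)) := by
    have hz1 : 1 ≤ x / x₁ := by rw [le_div_iff₀ hx₁]; linarith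
    have hzQ : x / x₁ ≤ Q := by rw [div_le_iff₀ hx₁]; exact hQx
    have hz : (x / x₁) ^ p ≤ 1 + H * (x / x₁ - 1) := by
      set z := x / x₁
      have hcv := (convexOn_rpow hp.le).2 (mem_Ici.2 (zero_le_one (α := ℝ)))
        (mem_Ici.2 (by linarith : (0:ℝ) ≤ Q))
        (div_nonneg (by linarith) (by linarith) : 0 ≤ (Q - z) / (Q - 1))
        (div_nonneg (by linarith) (by linarith) : 0 ≤ (z - 1) / (Q - 1))
        (by rw [← add_div, div_eq_one_iff_eq (by linarith)]; ring)
      have hQ1 : Q - 1 ≠ 0 := by linarith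
      have e : ((Q - z) / (Q - 1)) • (1:ℝ) + ((z - 1) / (Q - 1)) • Q = z := by
        simp only [smul_eq_mul]; field_simp; ring
      rw [e] at hcv
      refine hcv.trans (le_of_eq ?_)
      simp only [smul_eq_mul, Real.one_rpow, hH]
      field_simp; ring
    rw [Real.div_rpow hx.le hx₁.le, div_le_iff₀ hx1p] at hz
    linarith
  have htu := htan (u / x₁) (div_pos hu hx₁)
  rw [Real.div_rpow hu.le hx₁.le] at htu
  have htu' : δ ^ p * (x₁ ^ p * (1 + H * (u / x₁ - 1))) ≤ ε ^ p * u ^ p := by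
    have := mul_le_mul_of_nonneg_right htu hx1p.le
    have e : ε ^ p * (u ^ p / x₁ ^ p) * x₁ ^ p = ε ^ p * u ^ p := by field_simp
    rw [e] at this
    linarith
  -- affine interpolation
  have hA : ε ^ p * η ≤ δ ^ p * (x₁ ^ p * (1 + H * (x / x₁ - 1))) :=
    hη.trans (mul_le_mul_of_nonneg_left hchord hδp.le)
  have hB := mul_le_mul_of_nonneg_left hA (by linarith : (0:ℝ) ≤ u - x₁)
  have hC := mul_le_mul_of_nonneg_left hη₁ (by linarith : (0:ℝ) ≤ x - u)
  have hD := mul_le_mul_of_nonneg_left htu' (by linarith : (0:ℝ) ≤ x - x₁)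
  have hE : (u - x₁) * (δ ^ p * (x₁ ^ p * (1 + H * (x / x₁ - 1)))) + (x - u) * (δ ^ p * x₁ ^ p)
      = (x - x₁) * (δ ^ p * (x₁ ^ p * (1 + H * (u / x₁ - 1)))) := by
    field_simp; ring
  have hF : ε ^ p * ((x - u) * η₁) ≤ ε ^ p * ((x - x₁) * u ^ p - (u - x₁) * η) := by linarith
  have hG := le_of_mul_le_mul_left hF hεp
  have hI : (x - x₁) * u ^ p - (u - x₁) * η = (x - u) * gg p u x₁ := by
    rw [← hg, gg, gg, hup]; ring
  rw [hI] at hG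
  exact le_of_mul_le_mul_left hG (by linarith)

/-- Concavity step. -/
lemma concave_step {p δ Q H ε q x η x₁ η₁ x₂ η₂ u u₁ u₂ : ℝ} (hp : 1 < p) (hδ : 1 < δ)
    (hQ : 2 ≤ Q) (hH : H = (Q ^ p - 1) / (Q - 1))
    (hε : ε = H / p * ((p - 1) / (H - 1)) ^ ((p - 1) / p) * δ) (hq : q < 0)
    (hu : 0 < u) (hux : u ≤ x) (hg : gg p u x = η) (hη : ε ^ p * η ≤ δ ^ p * x ^ p)
    (hu₁ : 0 < u₁) (hux₁ : u₁ ≤ x₁) (hg₁ : gg p u₁ x₁ = η₁) (hη₁ : ε ^ p * η₁ ≤ δ ^ p * x₁ ^ p)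
    (hQx₁ : x ≤ Q * x₁)
    (hu₂ : 0 < u₂) (hux₂ : u₂ ≤ x₂) (hg₂ : gg p u₂ x₂ = η₂) (hη₂ : ε ^ p * η₂ ≤ δ ^ p * x₂ ^ p)
    (hQx₂ : x ≤ Q * x₂) (hxx : x = (x₁ + x₂) / 2) (hηη : η = (η₁ + η₂) / 2) :
    (gg q u₁ x₁ + gg q u₂ x₂) / 2 ≤ gg q u x := by
  have hpp : p * (p - 1) ≠ 0 := (mul_pos (by linarith) (by linarith)).ne'
  set κ := q * (q - 1) / (p * (p - 1)) with hκd
  have hκ : κ * (p * (p - 1)) = q * (q - 1) := div_mul_cancel₀ _ hpp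
  have h1 := child_le hp hδ hQ hH hε hq hκ hu hux hg hη hu₁ hux₁ hg₁ hη₁ hQx₁
  have h2 := child_le hp hδ hQ hH hε hq hκ hu hux hg hη hu₂ hux₂ hg₂ hη₂ hQx₂
  have e1 : gg q u x = (gg q u x₁ + gg q u x₂) / 2 := by rw [hxx]; unfold gg; ring
  have e2 : gg p u x = (gg p u x₁ + gg p u x₂) / 2 := by rw [hxx]; unfold gg; ring
  rw [e2] at hg
  have e3 : κ * u ^ (q - p) * (η₁ - gg p u x₁) + κ * u ^ (q - p) * (η₂ - gg p u x₂) = 0 := by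
    rw [← mul_add]
    have : η₁ - gg p u x₁ + (η₂ - gg p u x₂) = 0 := by linarith
    rw [this, mul_zero]
  rw [e1]; linarith

/-- value at the lower boundary -/
lemma lower_bd {p ε q sm x η u : ℝ} (hp : 1 < p) (hq : q < 0) (hε : 0 < ε) (hsm : sm ≤ 0)
    (hqs : 0 < 1 - q * sm) (hs : ε ^ p * (1 - p * sm) = (1 - sm) ^ p)
    (hu : 0 < u) (hux : u ≤ x) (hg : gg p u x = η) (hη : x ^ p ≤ ε ^ p * η) :
    x ^ q ≤ (1 - sm) ^ q / (1 - q * sm) * gg q u x := by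
  have hx : 0 < x := hu.trans_le hux
  have hs1 : 0 < 1 - sm := by linarith
  have hεp : 0 < ε ^ p := Real.rpow_pos_of_pos hε p
  set v := x / (1 - sm) with hv
  have hv0 : 0 < v := div_pos hx hs1
  have hvx : v ≤ x := div_le_self hx.le (by linarith)
  have hxv : x = v * (1 - sm) := by rw [hv]; field_simp
  have key : ∀ a : ℝ, gg a v x = v ^ a * (1 - a * sm) := by
    intro a
    have : v ^ a = v ^ (a - 1) * v := by rw [← Real.rpow_add_one hv0.ne']; ring_nf
    rw [gg, this]; linear_combination a * v ^ (a - 1) * hxv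
  have hxp : ∀ a : ℝ, x ^ a = v ^ a * (1 - sm) ^ a := by
    intro a; rw [← Real.mul_rpow hv0.le hs1.le, ← hxv]
  have h1 : gg p v x ≤ gg p u x := by
    rw [key, hg]
    refine le_of_mul_le_mul_left ?_ hεp
    refine le_trans (le_of_eq ?_) hη
    rw [hxp, ← hs]; ring
  have hpp : 0 < p * (p - 1) := mul_pos (by linarith) (by linarith)
  have hqq : 0 < q * (q - 1) := mul_pos_of_neg_of_neg hq (by linarith)
  have hvu : v ≤ u := ((gg_strictMonoOn hpp x).le_iff_le ⟨hv0, hvx⟩ ⟨hu, hux⟩).1 h1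
  have h2 : gg q v x ≤ gg q u x :=
    ((gg_strictMonoOn hqq x).le_iff_le ⟨hv0, hvx⟩ ⟨hu, hux⟩).2 hvu
  have hc : 0 ≤ (1 - sm) ^ q / (1 - q * sm) := by positivity
  refine le_trans (le_of_eq ?_) (mul_le_mul_of_nonneg_left h2 hc)
  have hne := hqs.ne'
  rw [key, hxp, div_mul_eq_mul_div, eq_div_iff hne]; ring

lemma avg_eq_setAverage (f : ℝ → ℝ) (n k : ℕ) : avg f n k = ⨍ t in dIcc n k, f t := by
  have h : (0:ℝ) ≤ 2 ^ (-(k:ℤ)) := by positivity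
  rw [setAverage_eq, avg, dIcc, Real.volume_real_Icc_of_le (by nlinarith)]
  have : ((n : ℝ) + 1) * 2 ^ (-(k : ℤ)) - (n : ℝ) * 2 ^ (-(k : ℤ)) = (2 ^ (k : ℤ))⁻¹ := by
    rw [zpow_neg]; ring
  rw [this, inv_inv, smul_eq_mul]

lemma vol_dIcc (n k : ℕ) : volume (dIcc n k) = ENNReal.ofReal (2 ^ (-(k : ℤ))) := by
  rw [dIcc, Real.volume_Icc]; congr 1; ring

lemma avg_eq_interval (f : ℝ → ℝ) (n k : ℕ) : avg f n k =
    2 ^ (k : ℤ) * ∫ t in ((n : ℝ) * 2 ^ (-(k : ℤ)))..(((n : ℝ) + 1) * 2 ^ (-(k : ℤ))), f t := by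
  have h : (0:ℝ) ≤ 2 ^ (-(k:ℤ)) := by positivity
  rw [avg, dIcc, integral_Icc_eq_integral_Ioc, intervalIntegral.integral_of_le (by nlinarith)]

lemma two_zpow_succ (k : ℕ) : (2:ℝ) ^ (-(k:ℤ)) = 2 * 2 ^ (-((k + 1 : ℕ):ℤ)) := by
  push_cast
  rw [← zpow_one_add₀ two_ne_zero]; congr 1; ring

lemma avg_split {f : ℝ → ℝ} (hf : LocallyIntegrable f volume) (n k : ℕ) :
    avg f n k = (avg f (2 * n) (k + 1) + avg f (2 * n + 1) (k + 1)) / 2 := by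
  have hi : ∀ a b : ℝ, IntervalIntegrable f volume a b := fun a b =>
    (hf.integrableOn_isCompact isCompact_uIcc).intervalIntegrable
  have h2 := two_zpow_succ k
  have e1 : (n : ℝ) * 2 ^ (-(k : ℤ)) = ((2 * n : ℕ) : ℝ) * 2 ^ (-((k + 1 : ℕ):ℤ)) := by
    rw [h2]; push_cast; ring
  have e2 : ((n : ℝ) + 1) * 2 ^ (-(k : ℤ)) =
      (((2 * n + 1 : ℕ) : ℝ) + 1) * 2 ^ (-((k + 1 : ℕ):ℤ)) := by
    rw [h2]; push_cast; ring
  have e3 : (((2 * n : ℕ) : ℝ) + 1) * 2 ^ (-((k + 1 : ℕ):ℤ)) =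
    ((2 * n + 1 : ℕ) : ℝ) * 2 ^ (-((k + 1 : ℕ):ℤ)) := by push_cast; ring
  have e4 : (2:ℝ) ^ ((k + 1 : ℕ):ℤ) = 2 * 2 ^ (k : ℤ) := by
    push_cast; rw [zpow_add_one₀ two_ne_zero]; ring
  rw [avg_eq_interval, avg_eq_interval, avg_eq_interval, e1, e2, e3, e4,
    ← intervalIntegral.integral_add_adjacent_intervals (hi _ _) (hi _ _)]
  ring

lemma avg_pos {w : ℝ → ℝ} (hw : LocallyIntegrable w volume)
    (hpos : ∀ᵐ t ∂(volume : Measure ℝ), 0 < w t) (n k : ℕ) : 0 < avg w n k := by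
  have h2 : (0:ℝ) < 2 ^ (k:ℤ) := by positivity
  refine mul_pos h2 ?_
  have hI : IntegrableOn w (dIcc n k) := hw.integrableOn_isCompact isCompact_Icc
  rw [integral_pos_iff_support_of_nonneg_ae
    (ae_restrict_of_ae (hpos.mono fun t ht => ht.le)) hI]
  have : volume.restrict (dIcc n k) (Function.support w) = volume.restrict (dIcc n k) univ := by
    apply measure_congr
    filter_upwards [ae_restrict_of_ae hpos] with t ht
    have : t ∈ Function.support w := ht.ne'
    exact propext ⟨fun _ => trivial, fun _ => this⟩
  rw [this, Measure.restrict_apply_univ, vol_dIcc]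
  simp only [ENNReal.ofReal_pos]; positivity

lemma avg_jensen {p : ℝ} (hp : 1 < p) {w : ℝ → ℝ} (hw : LocallyIntegrable w volume)
    (hwp : LocallyIntegrable (fun t => w t ^ p) volume)
    (hpos : ∀ᵐ t ∂(volume : Measure ℝ), 0 < w t) (n k : ℕ) :
    avg w n k ^ p ≤ avg (fun t => w t ^ p) n k := by
  rw [avg_eq_setAverage, avg_eq_setAverage]
  refine (convexOn_rpow hp.le).map_set_average_le
    (Real.continuous_rpow_const (by linarith)).continuousOn isClosed_Ici ?_ ?_ ?_
    (hw.integrableOn_isCompact isCompact_Icc) (hwp.integrableOn_isCompact isCompact_Icc)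
  · rw [vol_dIcc]; simp only [ne_eq, ENNReal.ofReal_eq_zero, not_le]; positivity
  · rw [vol_dIcc]; exact ENNReal.ofReal_ne_top
  · exact ae_restrict_of_ae (hpos.mono fun t ht => ht.le)

/-- half-open dyadic interval -/
def dIco (n k : ℕ) : Set ℝ :=
  Set.Ico ((n : ℝ) * 2 ^ (-(k : ℤ))) (((n : ℝ) + 1) * 2 ^ (-(k : ℤ)))

lemma mem_dIco_iff {n k : ℕ} {t : ℝ} (ht : 0 ≤ t) : t ∈ dIco n k ↔ ⌊t * 2 ^ k⌋₊ = n := by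
  have h2 : (0:ℝ) < 2 ^ k := by positivity
  rw [Nat.floor_eq_iff (by positivity), dIco, mem_Ico, zpow_neg, zpow_natCast, ← div_eq_mul_inv,
    ← div_eq_mul_inv, div_le_iff₀ h2, lt_div_iff₀ h2]

lemma nonneg_of_mem_dIco {n k : ℕ} {t : ℝ} (ht : t ∈ dIco n k) : 0 ≤ t :=
  le_trans (by positivity) ht.1

lemma dIco_split (n k : ℕ) : dIco n k = dIco (2 * n) (k + 1) ∪ dIco (2 * n + 1) (k + 1) := by
  have h2 := two_zpow_succ k
  have h : (0:ℝ) < 2 ^ (-((k + 1 : ℕ):ℤ)) := by positivity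
  unfold dIco
  rw [h2]
  generalize (2:ℝ) ^ (-((k + 1 : ℕ):ℤ)) = e at h
  push_cast
  rw [show (2 * (n:ℝ) + 1 + 1) * e = (n + 1) * (2 * e) by ring,
    show 2 * (n:ℝ) * e = n * (2 * e) by ring]
  rw [Ico_union_Ico_eq_Ico] <;> nlinarith

lemma vol_dIco (n k : ℕ) : volume (dIco n k) = ENNReal.ofReal (2 ^ (-(k : ℤ))) := by
  rw [dIco, Real.volume_Ico]; congr 1; ring

/-- dyadic conditional expectation -/
noncomputable def dE (w : ℝ → ℝ) (k : ℕ) (t : ℝ) : ℝ := avg w ⌊t * 2 ^ k⌋₊ k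

lemma measurable_dE (w : ℝ → ℝ) (k : ℕ) : Measurable (dE w k) := by
  have : Measurable fun n : ℕ => avg w n k := measurable_from_nat
  exact this.comp (Nat.measurable_floor.comp (measurable_id.mul_const _))

lemma main_ind {p δ Q H ε q sm : ℝ} (hp : 1 < p) (hδ : 1 < δ) (hQ : 2 ≤ Q)
    (hH : H = (Q ^ p - 1) / (Q - 1))
    (hε : ε = H / p * ((p - 1) / (H - 1)) ^ ((p - 1) / p) * δ) (hq : q < 0) (hsm : sm ≤ 0)
    (hqs : 0 < 1 - q * sm) (hs : ε ^ p * (1 - p * sm) = (1 - sm) ^ p)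
    {w : ℝ → ℝ} (hw : LocallyIntegrable w volume)
    (hwp : LocallyIntegrable (fun t => w t ^ p) volume)
    (hpos : ∀ᵐ t ∂(volume : Measure ℝ), 0 < w t)
    (hDb : ∀ n k : ℕ, avg w (n / 2) k ≤ Q * avg w n (k + 1)) (j : ℕ) :
    ∀ (n k : ℕ) (u : ℝ)
      (_ : ∀ j m : ℕ, m < 2 ^ j → avg (fun t => w t ^ p) (n * 2 ^ j + m) (k + j)
        ≤ δ ^ p * avg w (n * 2 ^ j + m) (k + j) ^ p),
      0 < u → u ≤ avg w n k → gg p u (avg w n k) = avg (fun t => w t ^ p) n k / ε ^ p →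
      ∫⁻ t in dIco n k, ENNReal.ofReal (dE w (k + j) t ^ q) ≤
        ENNReal.ofReal (2 ^ (-(k:ℤ)) * ((1 - sm) ^ q / (1 - q * sm) * gg q u (avg w n k))) := by
  obtain ⟨hδε, -⟩ := eps_facts hp hδ hQ hH hε
  have hε0 : 0 < ε := by linarith
  have hεp : 0 < ε ^ p := Real.rpow_pos_of_pos hε0 p
  induction j with
  | zero =>
    intro n k u hRH hu hux hg
    have e : ∫⁻ t in dIco n k, ENNReal.ofReal (dE w (k + 0) t ^ q)
        = ∫⁻ t in dIco n k, ENNReal.ofReal (avg w n k ^ q) := by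
      apply setLIntegral_congr_fun measurableSet_Ico
      intro t ht
      simp only [dE, add_zero]
      rw [(mem_dIco_iff (nonneg_of_mem_dIco ht)).1 ht]
    rw [e, setLIntegral_const, vol_dIco, ← ENNReal.ofReal_mul
      (Real.rpow_nonneg (avg_pos hw hpos n k).le q), mul_comm]
    apply ENNReal.ofReal_le_ofReal
    apply mul_le_mul_of_nonneg_left _ (by positivity)
    refine lower_bd hp hq hε0 hsm hqs hs hu hux hg ?_
    rw [mul_div_cancel₀ _ hεp.ne']
    exact avg_jensen hp hw hwp hpos n k
  | succ j ih =>
    intro n k u hRH hu hux hg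
    have hchild : ∀ b : ℕ, b < 2 → ∃ u', 0 < u' ∧ u' ≤ avg w (2 * n + b) (k + 1) ∧
        gg p u' (avg w (2 * n + b) (k + 1)) =
          avg (fun t => w t ^ p) (2 * n + b) (k + 1) / ε ^ p ∧
        ε ^ p * (avg (fun t => w t ^ p) (2 * n + b) (k + 1) / ε ^ p) ≤
          δ ^ p * avg w (2 * n + b) (k + 1) ^ p ∧
        avg w n k ≤ Q * avg w (2 * n + b) (k + 1) ∧
        ∫⁻ t in dIco (2 * n + b) (k + 1), ENNReal.ofReal (dE w (k + (j + 1)) t ^ q) ≤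
          ENNReal.ofReal (2 ^ (-((k + 1 : ℕ):ℤ)) * ((1 - sm) ^ q / (1 - q * sm) *
            gg q u' (avg w (2 * n + b) (k + 1)))) := by
      intro b hb
      have hRH' : ∀ j m : ℕ, m < 2 ^ j →
          avg (fun t => w t ^ p) ((2 * n + b) * 2 ^ j + m) (k + 1 + j)
          ≤ δ ^ p * avg w ((2 * n + b) * 2 ^ j + m) (k + 1 + j) ^ p := by
        intro j m hm
        have := hRH (j + 1) (b * 2 ^ j + m) (by rw [pow_succ]; nlinarith)
        have e1 : n * 2 ^ (j + 1) + (b * 2 ^ j + m) = (2 * n + b) * 2 ^ j + m := by ring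
        have e2 : k + (j + 1) = k + 1 + j := by ring
        rwa [e1, e2] at this
      have hR := hRH' 0 0 (by simp)
      simp only [pow_zero, mul_one, add_zero] at hR
      have hxp := avg_pos hw hpos (2 * n + b) (k + 1)
      have hyp : 0 < avg (fun t => w t ^ p) (2 * n + b) (k + 1) :=
        (Real.rpow_pos_of_pos hxp p).trans_le (avg_jensen hp hw hwp hpos _ _)
      obtain ⟨u', h1, h2, h3⟩ := exists_u hp hxp (div_pos hyp hεp) (by
        rw [div_le_iff₀ hεp]
        have := Real.rpow_lt_rpow (by linarith) hδε (by linarith : 0 < p)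
        have h3 := Real.rpow_pos_of_pos hxp p
        nlinarith)
      refine ⟨u', h1, h2, h3, ?_, ?_, ?_⟩
      · rwa [mul_div_cancel₀ _ hεp.ne']
      · have := hDb (2 * n + b) k
        rwa [show (2 * n + b) / 2 = n by omega] at this
      · have := ih (2 * n + b) (k + 1) u' hRH' h1 h2 h3
        rwa [show k + 1 + j = k + (j + 1) by ring] at this
    obtain ⟨u₁, a1, a2, a3, a4, a5, a6⟩ := hchild 0 (by norm_num)
    obtain ⟨u₂, b1, b2, b3, b4, b5, b6⟩ := hchild 1 (by norm_num)
    simp only [add_zero] at a1 a2 a3 a4 a5 a6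
    have hx := avg_split hw n k
    have hy := avg_split hwp n k
    have hR := hRH 0 0 (by simp)
    simp only [pow_zero, mul_one, add_zero] at hR
    have hcs := concave_step hp hδ hQ hH hε hq hu hux hg
      (by rwa [mul_div_cancel₀ _ hεp.ne']) a1 a2 a3 a4 a5 b1 b2 b3 b4 b5 hx
      (by rw [hy]; ring)
    have hc : 0 < (1 - sm) ^ q / (1 - q * sm) :=
      div_pos (Real.rpow_pos_of_pos (by linarith) q) hqs
    rw [dIco_split]
    refine (lintegral_union_le _ _ _).trans ((add_le_add a6 b6).trans ?_)
    have hnn : ∀ (v X Y : ℝ), 0 < v → v ≤ X → gg p v X = Y / ε ^ p → X ^ p ≤ Y →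
        0 ≤ (1 - sm) ^ q / (1 - q * sm) * gg q v X := by
      intro v X Y hv hvX hgv hXY
      refine (Real.rpow_nonneg (hv.le.trans hvX) q).trans
        (lower_bd hp hq hε0 hsm hqs hs hv hvX hgv ?_)
      rwa [mul_div_cancel₀ _ hεp.ne']
    have hz : (0:ℝ) < 2 ^ (-((k + 1 : ℕ):ℤ)) := by positivity
    rw [← ENNReal.ofReal_add
      (mul_nonneg hz.le (hnn _ _ _ a1 a2 a3 (avg_jensen hp hw hwp hpos _ _)))
      (mul_nonneg hz.le (hnn _ _ _ b1 b2 b3 (avg_jensen hp hw hwp hpos _ _)))]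
    apply ENNReal.ofReal_le_ofReal
    rw [two_zpow_succ k]
    have := mul_le_mul_of_nonneg_left hcs (mul_pos hz hc).le
    linarith

lemma dE_tendsto {w : ℝ → ℝ} (hw : LocallyIntegrable w volume) :
    ∀ᵐ t ∂(volume : Measure ℝ), 0 ≤ t →
      Filter.Tendsto (fun k => dE w k t) Filter.atTop (nhds (w t)) := by
  filter_upwards [IsUnifLocDoublingMeasure.ae_tendsto_average (μ := (volume : Measure ℝ)) hw 1]
    with t ht ht0
  have hball : ∀ n k : ℕ, dIcc n k =
      Metric.closedBall (((n : ℝ) + 1 / 2) * 2 ^ (-(k : ℤ))) (2 ^ (-(k : ℤ)) / 2) := by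
    intro n k
    rw [Real.closedBall_eq_Icc, dIcc]; congr 1 <;> ring
  have := ht (l := Filter.atTop)
    (fun k : ℕ => ((⌊t * 2 ^ k⌋₊ : ℝ) + 1 / 2) * 2 ^ (-(k : ℤ))) (fun k : ℕ => 2 ^ (-(k : ℤ)) / 2)
    ?_ ?_
  · refine this.congr fun k => ?_
    rw [← hball, dE, avg_eq_setAverage]
  · rw [tendsto_nhdsWithin_iff]
    constructor
    · have h := (tendsto_pow_atTop_nhds_zero_of_lt_one (r := (1/2 : ℝ)) (by norm_num)
        (by norm_num)).div_const 2
      rw [zero_div] at h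
      refine h.congr fun k => ?_
      rw [zpow_neg, zpow_natCast, one_div, inv_pow]
    · exact Filter.Eventually.of_forall fun k => mem_Ioi.2 (by positivity)
  · refine Filter.Eventually.of_forall fun k => ?_
    rw [one_mul, ← hball]
    exact Ico_subset_Icc_self ((mem_dIco_iff ht0).2 rfl)

lemma lint_bound {q C : ℝ} {w : ℝ → ℝ} (hw : LocallyIntegrable w volume)
    (hpos : ∀ᵐ t ∂(volume : Measure ℝ), 0 < w t) (n k : ℕ) (hC : 0 ≤ C)
    (h : ∀ j, ∫⁻ t in dIco n k, ENNReal.ofReal (dE w (k + j) t ^ q) ≤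
      ENNReal.ofReal (2 ^ (-(k:ℤ)) * C)) : avg (fun t => w t ^ q) n k ≤ C := by
  have hz : (0:ℝ) < 2 ^ (k : ℤ) := by positivity
  have hF : ∫⁻ t in dIco n k, ENNReal.ofReal (w t ^ q) ≤ ENNReal.ofReal (2 ^ (-(k:ℤ)) * C) := by
    calc ∫⁻ t in dIco n k, ENNReal.ofReal (w t ^ q)
        = ∫⁻ t in dIco n k, Filter.liminf
            (fun j => ENNReal.ofReal (dE w (k + j) t ^ q)) Filter.atTop := by
          apply lintegral_congr_ae
          filter_upwards [ae_restrict_of_ae hpos, ae_restrict_of_ae (dE_tendsto hw),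
            ae_restrict_mem measurableSet_Ico] with t h1 h2 h3
          have h4 := h2 (nonneg_of_mem_dIco h3)
          have h5 : Filter.Tendsto (fun j => dE w (k + j) t) Filter.atTop (nhds (w t)) := by
            have := (Filter.tendsto_add_atTop_iff_nat k).2 h4
            refine this.congr fun j => by rw [add_comm]
          exact ((ENNReal.continuous_ofReal.tendsto _).comp
            (h5.rpow_const (Or.inl h1.ne'))).liminf_eq.symm
      _ ≤ Filter.liminf (fun j => ∫⁻ t in dIco n k,
            ENNReal.ofReal (dE w (k + j) t ^ q)) Filter.atTop :=
          lintegral_liminf_le fun j => ((measurable_dE w (k + j)).pow_const q).ennreal_ofReal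
      _ ≤ Filter.liminf (fun _ : ℕ => ENNReal.ofReal (2 ^ (-(k:ℤ)) * C)) Filter.atTop :=
          Filter.liminf_le_liminf (Filter.Eventually.of_forall h)
      _ = _ := Filter.liminf_const _
  have hm : AEStronglyMeasurable (fun t => w t ^ q) (volume.restrict (dIco n k)) :=
    (hw.aestronglyMeasurable.aemeasurable.pow_const q).aestronglyMeasurable.restrict
  rw [avg, dIcc, integral_Icc_eq_integral_Ico]
  change _ * ∫ t in dIco n k, w t ^ q ≤ C
  rw [integral_eq_lintegral_of_nonneg_ae
    (ae_restrict_of_ae (hpos.mono fun t ht => Real.rpow_nonneg ht.le q)) hm]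
  have := ENNReal.toReal_le_of_le_ofReal (by positivity) hF
  calc _ ≤ (2:ℝ) ^ (k : ℤ) * (2 ^ (-(k:ℤ)) * C) := mul_le_mul_of_nonneg_left this hz.le
    _ = C := by rw [zpow_neg]; field_simp

/-- **Main Theorem.**  Let `p>1`, `δ>1`, `Q≥2`, `H = (Q^p−1)/(Q−1)`,
`ε = (H/p)·((p−1)/(H−1))^((p−1)/p)·δ`, and let `s⁻ = u⁻(1/ε)` (i.e. the solution `sm ≤ 0`
of `(1−p·sm)^(1/p)(1−sm)⁻¹ = 1/ε`).  Let `q ∈ (1/s⁻, 0)`.  If `w` is a weight on the dyadic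
interval `J = [N·2^(-K), (N+1)·2^(-K)]` lying in `RH_p^{δ,d}(J)` with dyadic doubling
constant at most `Q`, and `x = ⟨w⟩_J`, `y = ⟨w^p⟩_J`, `r⁻ = u⁻(y^(1/p)/(ε·x))`, then
`⟨w^q⟩_J ≤ x^q·(1−q·r⁻)/(1−q·s⁻)·((1−s⁻)/(1−r⁻))^q`. -/
theorem stmt0 (p δ Q H ε q : ℝ) (hp : 1 < p) (hδ : 1 < δ) (hQ : 2 ≤ Q)
    (hH : H = (Q ^ p - 1) / (Q - 1))
    (hε : ε = H / p * ((p - 1) / (H - 1)) ^ ((p - 1) / p) * δ)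
    (sm : ℝ) (hsm_neg : sm ≤ 0)
    (hsm : (1 - p * sm) ^ (1 / p) * (1 - sm)⁻¹ = 1 / ε)
    (hq : q ∈ Set.Ioo (1 / sm) 0)
    (N K : ℕ) (w : ℝ → ℝ)
    (hw_loc : LocallyIntegrable w volume)
    (hwp_loc : LocallyIntegrable (fun t => w t ^ p) volume)
    (hw_pos : ∀ᵐ t ∂(volume : Measure ℝ), 0 < w t)
    -- `w ∈ RH_p^{δ,d}(J)` : for every dyadic subinterval `I ∈ D(J)`,
    -- `⟨w^p⟩_I^(1/p) ≤ δ·⟨w⟩_I`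
    (hRH : ∀ j m : ℕ, m < 2 ^ j →
      (avg (fun t => w t ^ p) (N * 2 ^ j + m) (K + j)) ^ (1 / p)
        ≤ δ * avg w (N * 2 ^ j + m) (K + j))
    -- `Db^d(w) ≤ Q` : for every dyadic interval, the average over its dyadic parent
    -- is at most `Q` times the average over the interval
    (hDb : ∀ n k : ℕ, avg w (n / 2) k ≤ Q * avg w n (k + 1))
    (x y : ℝ) (hx : x = avg w N K) (hy : y = avg (fun t => w t ^ p) N K)
    (rm : ℝ) (hrm_neg : rm ≤ 0)
    (hrm : (1 - p * rm) ^ (1 / p) * (1 - rm)⁻¹ = y ^ (1 / p) / (ε * x)) :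
    avg (fun t => w t ^ q) N K
      ≤ x ^ q * ((1 - q * rm) / (1 - q * sm)) * ((1 - sm) / (1 - rm)) ^ q := by
  have hp0 : 0 < p := by linarith
  obtain ⟨hδε, -⟩ := eps_facts hp hδ hQ hH hε
  have hε0 : 0 < ε := by linarith
  have hεp : 0 < ε ^ p := Real.rpow_pos_of_pos hε0 p
  have hq0 : q < 0 := hq.2
  have hsm0 : sm < 0 := by
    refine lt_of_le_of_ne hsm_neg ?_
    rintro rfl
    have := hq.1
    simp at this
    linarith
  have hqs : 0 < 1 - q * sm := by
    have := mul_lt_mul_of_neg_right hq.1 hsm0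
    rw [one_div, inv_mul_cancel₀ hsm0.ne] at this
    linarith
  have hpow : ∀ r z : ℝ, r ≤ 0 → 0 ≤ z → (1 - p * r) ^ (1 / p) * (1 - r)⁻¹ = z →
      1 - p * r = z ^ p * (1 - r) ^ p := by
    intro r z hr hz h
    have h1 : 0 < 1 - r := by linarith
    have h2 : 0 ≤ 1 - p * r := by nlinarith
    rw [← Real.mul_rpow hz h1.le, ← h, inv_mul_cancel_right₀ h1.ne', ← Real.rpow_mul h2,
      one_div_mul_cancel hp0.ne', Real.rpow_one]
  have hs : ε ^ p * (1 - p * sm) = (1 - sm) ^ p := by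
    rw [hpow sm _ hsm_neg (by positivity) hsm, Real.div_rpow zero_le_one hε0.le, Real.one_rpow]
    field_simp
  have hx0 : 0 < x := hx ▸ avg_pos hw_loc hw_pos N K
  have hxy : x ^ p ≤ y := by
    rw [hx, hy]; exact avg_jensen hp hw_loc hwp_loc hw_pos N K
  have hy0 : 0 < y := (Real.rpow_pos_of_pos hx0 p).trans_le hxy
  have hr1 : 0 < 1 - rm := by linarith
  have hr : 1 - p * rm = y / (ε ^ p * x ^ p) * (1 - rm) ^ p := by
    rw [hpow rm _ hrm_neg (by positivity) hrm, Real.div_rpow (by positivity) (by positivity),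
      ← Real.rpow_mul hy0.le, one_div_mul_cancel hp0.ne', Real.rpow_one,
      Real.mul_rpow hε0.le hx0.le]
  set u := x / (1 - rm) with hu
  have hu0 : 0 < u := div_pos hx0 hr1
  have hux : u ≤ x := div_le_self hx0.le (by linarith)
  have hxu : x = u * (1 - rm) := by rw [hu]; field_simp
  have key : ∀ a : ℝ, gg a u x = u ^ a * (1 - a * rm) := by
    intro a
    have : u ^ a = u ^ (a - 1) * u := by rw [← Real.rpow_add_one hu0.ne']; ring_nf
    rw [gg, this]; linear_combination a * u ^ (a - 1) * hxu
  have hua : ∀ a : ℝ, u ^ a = x ^ a / (1 - rm) ^ a := fun a => Real.div_rpow hx0.le hr1.le a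
  have hg : gg p u x = y / ε ^ p := by
    have h1 := Real.rpow_pos_of_pos hx0 p
    have h2 := Real.rpow_pos_of_pos hr1 p
    rw [key, hr, hua]
    field_simp
  have hB : x ^ q * ((1 - q * rm) / (1 - q * sm)) * ((1 - sm) / (1 - rm)) ^ q
      = (1 - sm) ^ q / (1 - q * sm) * gg q u x := by
    rw [key, hua, Real.div_rpow (by linarith) hr1.le]
    ring
  rw [hB]
  have hRH' : ∀ j m : ℕ, m < 2 ^ j → avg (fun t => w t ^ p) (N * 2 ^ j + m) (K + j)
        ≤ δ ^ p * avg w (N * 2 ^ j + m) (K + j) ^ p := by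
    intro j m hm
    have h1 := avg_pos hw_loc hw_pos (N * 2 ^ j + m) (K + j)
    have h2 : 0 ≤ avg (fun t => w t ^ p) (N * 2 ^ j + m) (K + j) :=
      (Real.rpow_nonneg h1.le p).trans (avg_jensen hp hw_loc hwp_loc hw_pos _ _)
    have h3 := Real.rpow_le_rpow (Real.rpow_nonneg h2 _) (hRH j m hm) hp0.le
    rwa [← Real.rpow_mul h2, one_div_mul_cancel hp0.ne', Real.rpow_one,
      Real.mul_rpow (by linarith) h1.le] at h3
  have hnn : 0 ≤ (1 - sm) ^ q / (1 - q * sm) * gg q u x :=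
    (Real.rpow_nonneg hx0.le q).trans
      (lower_bd hp hq0 hε0 hsm_neg hqs hs hu0 hux hg (by rwa [mul_div_cancel₀ _ hεp.ne']))
  refine lint_bound hw_loc hw_pos N K hnn fun j => ?_
  have := main_ind hp hδ hQ hH hε hq0 hsm_neg hqs hs hw_loc hwp_loc hw_pos hDb j N K u hRH' hu0
    (hx ▸ hux) (by rw [← hx, ← hy]; exact hg)
  rwa [← hx] at this
end

section
/- Let p>1, δ>1, Q≥2, set H := (Q^p−1)/(Q−1) and ε := (H/p)·((p−1)/(H−1))^{(p−1)/p}·δ, let s^- := u^-(1/ε), and let q ∈ (1/s^-, 0). Define B_max on Ω_ε := {(x,y): x>0, x^p ≤ y ≤ ε^p x^p} by B_max(x,y) := y^{q/p}·(1 − q·r^-(x,y))/(1 − q·s^-)·((1 − p·s^-)/(1 − p·r^-(x,y)))^{q/p}, where r^-(x,y) := u^-(y^{1/p}/(εx)). Then B_max is midpoint concave along segments contained in Ω_ε: for all a, b ∈ Ω_ε such that the segment joining a and b lies in Ω_ε, B_max((a+b)/2) ≥ (B_max(a) + B_max(b))/2. -/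
/-- height of the tangent line at `w` to the curve `v = x ^ p`, at abscissa `x` -/
noncomputable def gT (p x w : ℝ) : ℝ := p * x * w ^ (p - 1) - (p - 1) * w ^ p

/-- supporting planes, scaled by `p (p-1)` -/
noncomputable def LPl (p q x v w : ℝ) : ℝ :=
  -(q * (1 - q)) * w ^ (q - p) * v + p * q * (p - q) * w ^ (q - 1) * x
    + (p - 1) * (1 - q) * (p - q) * w ^ q

theorem gT_hasDeriv (p x w : ℝ) (hw : 0 < w) :
    HasDerivAt (gT p x) (p * (p - 1) * w ^ (p - 2) * (x - w)) w := by
  have h1 := (Real.hasDerivAt_rpow_const (p := p - 1) (Or.inl hw.ne')).const_mul (p * x)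
  have h2 := (Real.hasDerivAt_rpow_const (p := p) (Or.inl hw.ne')).const_mul (p - 1)
  have h := h1.sub h2
  have e : w ^ (p - 1) = w ^ (p - 2) * w := by
    rw [← Real.rpow_add_one hw.ne']; congr 1; ring
  have e2 : p - 1 - 1 = p - 2 := by ring
  rw [e2, e] at h
  have h' : HasDerivAt (gT p x) _ w := h
  exact h'.congr_deriv (by ring)

theorem LPl_hasDeriv (p q x v w : ℝ) (hw : 0 < w) :
    HasDerivAt (LPl p q x v) (q * (1 - q) * (p - q) * w ^ (q - p - 1) * (v - gT p x w)) w := by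
  have h1 := ((Real.hasDerivAt_rpow_const (p := q - p) (Or.inl hw.ne')).const_mul
    (-(q * (1 - q)))).mul_const v
  have h2 := ((Real.hasDerivAt_rpow_const (p := q - 1) (Or.inl hw.ne')).const_mul
    (p * q * (p - q))).mul_const x
  have h3 := (Real.hasDerivAt_rpow_const (p := q) (Or.inl hw.ne')).const_mul
    ((p - 1) * (1 - q) * (p - q))
  have h := (h1.add h2).add h3
  have e1 : w ^ (q - 1 - 1) = w ^ (q - p - 1) * w ^ (p - 1) := by
    rw [← Real.rpow_add hw]; congr 1; ring
  have e2 : w ^ (q - 1) = w ^ (q - p - 1) * w ^ p := by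
    rw [← Real.rpow_add hw]; congr 1; ring
  rw [e1, e2] at h
  have h' : HasDerivAt (LPl p q x v) _ w := h
  exact h'.congr_deriv (by unfold gT; ring)

theorem gT_mono {p x u v : ℝ} (hp : 1 < p) (hu : 0 < u) (huv : u ≤ v) (hv : v ≤ x) :
    gT p x u ≤ gT p x v := by
  have hpos : ∀ w ∈ Set.Icc u v, 0 < w := fun w hw => lt_of_lt_of_le hu hw.1
  have : MonotoneOn (gT p x) (Set.Icc u v) := by
    apply monotoneOn_of_deriv_nonneg (convex_Icc u v)
    · intro w hw
      exact (gT_hasDeriv p x w (hpos w hw)).continuousAt.continuousWithinAt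
    · intro w hw
      exact (gT_hasDeriv p x w (hpos w (interior_subset hw))).differentiableAt.differentiableWithinAt
    · intro w hw
      have hw' := interior_subset hw
      have h0 := hpos w hw'
      rw [(gT_hasDeriv p x w h0).deriv]
      have : 0 < w ^ (p - 2) := Real.rpow_pos_of_pos h0 _
      have h1 : 0 ≤ x - w := by linarith [hw'.2]
      have h2 : 0 < p - 1 := by linarith
      have h3 : 0 < p := by linarith
      positivity
  exact this (Set.left_mem_Icc.2 huv) (Set.right_mem_Icc.2 huv) huv

theorem gT_anti {p x u v : ℝ} (hp : 1 < p) (hu : 0 < u) (huv : u ≤ v) (hv : x ≤ u) :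
    gT p x v ≤ gT p x u := by
  have hpos : ∀ w ∈ Set.Icc u v, 0 < w := fun w hw => lt_of_lt_of_le hu hw.1
  have : AntitoneOn (gT p x) (Set.Icc u v) := by
    apply antitoneOn_of_deriv_nonpos (convex_Icc u v)
    · intro w hw
      exact (gT_hasDeriv p x w (hpos w hw)).continuousAt.continuousWithinAt
    · intro w hw
      exact (gT_hasDeriv p x w (hpos w (interior_subset hw))).differentiableAt.differentiableWithinAt
    · intro w hw
      have hw' := interior_subset hw
      have h0 := hpos w hw'
      rw [(gT_hasDeriv p x w h0).deriv]
      have : 0 < w ^ (p - 2) := Real.rpow_pos_of_pos h0 _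
      have h1 : x - w ≤ 0 := by linarith [hw'.1]
      have h2 : 0 < p - 1 := by linarith
      have h3 : 0 < p := by linarith
      exact mul_nonpos_of_nonneg_of_nonpos (by positivity) h1
  exact this (Set.left_mem_Icc.2 huv) (Set.right_mem_Icc.2 huv) huv

theorem LPl_supp {p q x v w1 w2 : ℝ} (hp : 1 < p) (hq : q < 0) (h1 : 0 < w1) (h1x : w1 ≤ x)
    (hv : v = gT p x w1) (h2 : 0 < w2) (h : w2 ≤ x ∨ v ≤ gT p x w2) :
    LPl p q x v w1 ≤ LPl p q x v w2 := by
  have hc : ∀ w : ℝ, 0 < w → q * (1 - q) * (p - q) * w ^ (q - p - 1) ≤ 0 := by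
    intro w hw
    have a1 : 0 < w ^ (q - p - 1) := Real.rpow_pos_of_pos hw _
    have a2 : 0 < 1 - q := by linarith
    have a3 : 0 < p - q := by linarith
    have : 0 < (1 - q) * (p - q) * w ^ (q - p - 1) := by positivity
    nlinarith
  rcases le_total w2 w1 with hle | hle
  · have hpos : ∀ w ∈ Set.Icc w2 w1, 0 < w := fun w hw => lt_of_lt_of_le h2 hw.1
    have : AntitoneOn (LPl p q x v) (Set.Icc w2 w1) := by
      apply antitoneOn_of_deriv_nonpos (convex_Icc _ _)
      · intro w hw
        exact (LPl_hasDeriv p q x v w (hpos w hw)).continuousAt.continuousWithinAt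
      · intro w hw
        exact (LPl_hasDeriv p q x v w (hpos w (interior_subset hw))).differentiableAt.differentiableWithinAt
      · intro w hw
        have hw' := interior_subset hw
        have h0 := hpos w hw'
        rw [(LPl_hasDeriv p q x v w h0).deriv]
        have := gT_mono hp h0 hw'.2 h1x
        exact mul_nonpos_of_nonpos_of_nonneg (hc w h0) (by linarith)
    exact this (Set.left_mem_Icc.2 hle) (Set.right_mem_Icc.2 hle) hle
  · have hpos : ∀ w ∈ Set.Icc w1 w2, 0 < w := fun w hw => lt_of_lt_of_le h1 hw.1
    have : MonotoneOn (LPl p q x v) (Set.Icc w1 w2) := by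
      apply monotoneOn_of_deriv_nonneg (convex_Icc _ _)
      · intro w hw
        exact (LPl_hasDeriv p q x v w (hpos w hw)).continuousAt.continuousWithinAt
      · intro w hw
        exact (LPl_hasDeriv p q x v w (hpos w (interior_subset hw))).differentiableAt.differentiableWithinAt
      · intro w hw
        have hw' := interior_subset hw
        have h0 := hpos w hw'
        rw [(LPl_hasDeriv p q x v w h0).deriv]
        apply mul_nonneg_of_nonpos_of_nonpos (hc w h0)
        rcases le_total w x with hx | hx
        · have := gT_mono hp h1 hw'.1 hx
          linarith
        · have a2 := gT_anti hp h0 hw'.2 hx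
          rcases h with h | h
          · have : w = x := le_antisymm (hw'.2.trans h) hx
            have := gT_mono hp h1 hw'.1 this.le
            linarith
          · linarith
    exact this (Set.left_mem_Icc.2 hle) (Set.right_mem_Icc.2 hle) hle

theorem LPl_diag (p q x w : ℝ) (hw : 0 < w) :
    LPl p q x (gT p x w) w = p * (p - 1) * ((1 - q) * w ^ q + q * x * w ^ (q - 1)) := by
  have e1 : w ^ (q - 1) = w ^ (q - p) * w ^ (p - 1) := by
    rw [← Real.rpow_add hw]; congr 1; ring
  have e2 : w ^ q = w ^ (q - p) * w ^ p := by
    rw [← Real.rpow_add hw]; congr 1; ring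
  unfold LPl gT
  rw [e1, e2]
  ring

theorem tang {p xa va xb vb w : ℝ} (hw : 0 < w)
    (hwm : w ≤ (xa + xb) / 2) (hxa : xa < w)
    (hm : (va + vb) / 2 = gT p ((xa + xb) / 2) w)
    (hs : ∀ t ∈ Set.Icc (0:ℝ) 1, va + t * (vb - va) ≤ (xa + t * (xb - xa)) ^ p) :
    va ≤ gT p xa w := by
  have hX : 0 < xb - xa := by linarith
  have e : w ^ p = w ^ (p - 1) * w := by
    rw [← Real.rpow_add_one hw.ne']; congr 1; ring
  unfold gT at hm ⊢
  rw [e] at hm ⊢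
  have key : p * w ^ (p - 1) * (xb - xa) ≤ vb - va := by
    rcases hwm.lt_or_eq with h | h
    · have ht := hs ((w - xa) / (xb - xa))
        ⟨div_nonneg (by linarith) hX.le, (div_le_one hX).2 (by linarith)⟩
      have e3 : xa + (w - xa) / (xb - xa) * (xb - xa) = w := by field_simp; ring
      rw [e3, e] at ht
      have e4 : (w - xa) / (xb - xa) * (xb - xa) = (w - xa) := by field_simp
      set t := (w - xa) / (xb - xa) with htd
      have h12 : t < 1 / 2 := by rw [htd, div_lt_iff₀ hX]; linarith
      have e5 : w = xa + t * (xb - xa) := by linarith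
      -- vm - vz = (1/2 - t) D ,  xm - w = (1/2 - t) X
      have : (1 / 2 - t) * (p * w ^ (p - 1) * (xb - xa)) ≤ (1 / 2 - t) * (vb - va) := by
        have e6 : (1 / 2 - t) * (p * w ^ (p - 1) * (xb - xa))
          = p * w ^ (p - 1) * ((xa + xb) / 2 - w) := by
          have : (1 / 2 - t) * (xb - xa) = (xa + xb) / 2 - w := by linarith
          rw [← this]; ring
        rw [e6]
        linarith
      exact le_of_mul_le_mul_left this (by linarith)
    · have hd : HasDerivAt (fun t : ℝ => (xa + t * (xb - xa)) ^ p - (va + t * (vb - va)))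
          (1 * (xb - xa) * p * (xa + 1 / 2 * (xb - xa)) ^ (p - 1) - 1 * (vb - va)) (1 / 2) := by
        have hx : xa + 1 / 2 * (xb - xa) ≠ 0 := by
          have : xa + 1 / 2 * (xb - xa) = w := by linarith
          rw [this]; exact hw.ne'
        have d1 := (((hasDerivAt_id (1 / 2 : ℝ)).mul_const (xb - xa)).const_add xa).rpow_const
          (p := p) (Or.inl hx)
        have d2 := ((hasDerivAt_id (1 / 2 : ℝ)).mul_const (vb - va)).const_add va
        exact d1.sub d2
      have hmin : IsLocalMin (fun t : ℝ => (xa + t * (xb - xa)) ^ p - (va + t * (vb - va)))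
          (1 / 2) := by
        filter_upwards [Icc_mem_nhds (show (0:ℝ) < 1 / 2 by norm_num)
          (show (1 / 2 : ℝ) < 1 by norm_num)] with t ht
        have a1 := hs t ht
        have a2 : xa + 1 / 2 * (xb - xa) = w := by linarith
        rw [a2, e]
        rw [← h] at hm
        linarith
      have := hmin.hasDerivAt_eq_zero hd
      have a2 : xa + 1 / 2 * (xb - xa) = w := by linarith
      rw [a2] at this
      linarith
  linarith

theorem B_form {p q ε sm x y r : ℝ} (hp : 1 < p) (hε : 0 < ε) (hs : 0 < 1 - p * sm)
    (hx : 0 < x) (hy : 0 < y) (hr : r ≤ 0)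
    (h : (1 - p * r) ^ (1 / p) * (1 - r)⁻¹ = y ^ (1 / p) / (ε * x)) :
    y / ε ^ p = gT p x (x / (1 - r)) ∧
    y ^ (q / p) * ((1 - q * r) / (1 - q * sm)) * ((1 - p * sm) / (1 - p * r)) ^ (q / p)
      = ε ^ q * (1 - p * sm) ^ (q / p) / (1 - q * sm) *
        ((1 - q) * (x / (1 - r)) ^ q + q * x * (x / (1 - r)) ^ (q - 1)) := by
  have h1 : 0 < 1 - r := by linarith
  have h2 : 0 < 1 - p * r := by nlinarith
  have hp0 : p ≠ 0 := by linarith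
  set w := x / (1 - r) with hw
  have hw0 : 0 < w := by positivity
  have hxw : x = w * (1 - r) := by rw [hw]; field_simp
  have hy1 : y ^ (1 / p) = ε * w * (1 - p * r) ^ (1 / p) := by
    rw [hw]; field_simp at h ⊢; linarith
  have hy2 : y = ε ^ p * w ^ p * (1 - p * r) := by
    have : (y ^ (1 / p)) ^ p = y := by
      rw [← Real.rpow_mul hy.le, one_div_mul_cancel hp0, Real.rpow_one]
    rw [← this, hy1, Real.mul_rpow (by positivity) (by positivity),
      Real.mul_rpow hε.le hw0.le, ← Real.rpow_mul h2.le, one_div_mul_cancel hp0, Real.rpow_one]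
  have hy3 : y ^ (q / p) = ε ^ q * w ^ q * (1 - p * r) ^ (q / p) := by
    rw [hy2, Real.mul_rpow (by positivity) (by positivity),
      Real.mul_rpow (by positivity) (by positivity), ← Real.rpow_mul hε.le,
      ← Real.rpow_mul hw0.le, mul_div_cancel₀ _ hp0]
  have ep : w ^ p = w ^ (p - 1) * w := by
    rw [← Real.rpow_add_one hw0.ne']; congr 1; ring
  have eq : w ^ q = w ^ (q - 1) * w := by
    rw [← Real.rpow_add_one hw0.ne']; congr 1; ring
  constructor
  · have : ε ^ p ≠ 0 := by positivity
    rw [hy2, gT, hxw, ep]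
    field_simp
    ring
  · have : (1 - p * r) ^ (q / p) ≠ 0 := by positivity
    rw [hy3, Real.div_rpow hs.le h2.le, hxw, eq]
    field_simp
    ring

/-- Let `p>1`, `δ>1`, `Q≥2`, `H = (Q^p−1)/(Q−1)`,
`ε = (H/p)·((p−1)/(H−1))^((p−1)/p)·δ`, `s⁻ = u⁻(1/ε)` and `q ∈ (1/s⁻, 0)`.  Define, on
`Ω_ε = {(x,y) : x>0, x^p ≤ y ≤ ε^p x^p}`,
`B_max(x,y) = y^(q/p)·(1−q·r⁻(x,y))/(1−q·s⁻)·((1−p·s⁻)/(1−p·r⁻(x,y)))^(q/p)` where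
`r⁻(x,y) = u⁻(y^(1/p)/(εx))`.  Then `B_max` is midpoint concave along segments contained
in `Ω_ε`: for `a, b ∈ Ω_ε` with the segment joining them inside `Ω_ε`,
`B_max((a+b)/2) ≥ (B_max(a)+B_max(b))/2`. -/
theorem stmt16 (p δ Q H ε q sm : ℝ) (hp : 1 < p) (hδ : 1 < δ) (hQ : 2 ≤ Q)
    (hH : H = (Q ^ p - 1) / (Q - 1))
    (hε : ε = H / p * ((p - 1) / (H - 1)) ^ ((p - 1) / p) * δ)
    (hsm_neg : sm ≤ 0)
    (hsm : (1 - p * sm) ^ (1 / p) * (1 - sm)⁻¹ = 1 / ε)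
    (hq : q ∈ Set.Ioo (1 / sm) 0)
    (rm : ℝ → ℝ → ℝ)
    (hrm : ∀ x y : ℝ, 0 < x → x ^ p ≤ y → y ≤ ε ^ p * x ^ p →
      rm x y ≤ 0 ∧ (1 - p * rm x y) ^ (1 / p) * (1 - rm x y)⁻¹ = y ^ (1 / p) / (ε * x))
    (B : ℝ → ℝ → ℝ)
    (hB : ∀ x y : ℝ, B x y
      = y ^ (q / p) * ((1 - q * rm x y) / (1 - q * sm))
          * ((1 - p * sm) / (1 - p * rm x y)) ^ (q / p))
    (a b : ℝ × ℝ)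
    (ha : 0 < a.1 ∧ a.1 ^ p ≤ a.2 ∧ a.2 ≤ ε ^ p * a.1 ^ p)
    (hb : 0 < b.1 ∧ b.1 ^ p ≤ b.2 ∧ b.2 ≤ ε ^ p * b.1 ^ p)
    (hseg : segment ℝ a b ⊆
      {z : ℝ × ℝ | 0 < z.1 ∧ z.1 ^ p ≤ z.2 ∧ z.2 ≤ ε ^ p * z.1 ^ p}) :
    B ((a.1 + b.1) / 2) ((a.2 + b.2) / 2) ≥ (B a.1 a.2 + B b.1 b.2) / 2 := by
  obtain ⟨hq1, hq0⟩ := hq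
  have hs : sm < 0 := by
    rcases hsm_neg.lt_or_eq with h | h
    · exact h
    · rw [h] at hq1; norm_num at hq1; linarith
  have hqs : 0 < 1 - q * sm := by
    have := (div_lt_iff_of_neg hs).1 hq1
    linarith
  have hps : 0 < 1 - p * sm := by nlinarith
  have hε0 : 0 < ε := by
    have h1 : 0 < 1 - sm := by linarith
    have : 0 < 1 / ε := by rw [← hsm]; positivity
    exact one_div_pos.1 this
  have hεp : 0 < ε ^ p := by positivity
  have hCpos : 0 < ε ^ q * (1 - p * sm) ^ (q / p) / (1 - q * sm) := by positivity
  have main : ∀ z : ℝ × ℝ, 0 < z.1 ∧ z.1 ^ p ≤ z.2 ∧ z.2 ≤ ε ^ p * z.1 ^ p →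
      ∃ w, 0 < w ∧ w ≤ z.1 ∧ z.2 / ε ^ p = gT p z.1 w ∧
        p * (p - 1) * B z.1 z.2 = ε ^ q * (1 - p * sm) ^ (q / p) / (1 - q * sm) *
          LPl p q z.1 (z.2 / ε ^ p) w := by
    rintro z ⟨h1, h2, h3⟩
    obtain ⟨hr, hr'⟩ := hrm _ _ h1 h2 h3
    have hy : 0 < z.2 := lt_of_lt_of_le (by positivity) h2
    obtain ⟨f1, f2⟩ := B_form (q := q) hp hε0 hps h1 hy hr hr'
    have h1r : 0 < 1 - rm z.1 z.2 := by linarith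
    have hw : 0 < z.1 / (1 - rm z.1 z.2) := by positivity
    refine ⟨_, hw, div_le_self h1.le (by linarith), f1, ?_⟩
    rw [f1, LPl_diag _ _ _ _ hw, hB, f2]
    ring
  have hsg : ∀ t ∈ Set.Icc (0:ℝ) 1, 0 < a.1 + t * (b.1 - a.1) ∧
      (a.1 + t * (b.1 - a.1)) ^ p ≤ a.2 + t * (b.2 - a.2) ∧
      a.2 + t * (b.2 - a.2) ≤ ε ^ p * (a.1 + t * (b.1 - a.1)) ^ p := by
    intro t ht
    have : a + t • (b - a) ∈ segment ℝ a b := by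
      rw [segment_eq_image']
      exact ⟨t, ht, rfl⟩
    simpa using hseg this
  have hmid : 0 < (a.1 + b.1) / 2 ∧ ((a.1 + b.1) / 2) ^ p ≤ (a.2 + b.2) / 2 ∧
      (a.2 + b.2) / 2 ≤ ε ^ p * ((a.1 + b.1) / 2) ^ p := by
    have := hsg (1 / 2) (by constructor <;> norm_num)
    have e1 : a.1 + 1 / 2 * (b.1 - a.1) = (a.1 + b.1) / 2 := by ring
    have e2 : a.2 + 1 / 2 * (b.2 - a.2) = (a.2 + b.2) / 2 := by ring
    rwa [e1, e2] at this
  obtain ⟨wa, wa0, wax, wav, wB⟩ := main a ha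
  obtain ⟨wb, wb0, wbx, wbv, wB'⟩ := main b hb
  obtain ⟨wm, wm0, wmx, wmv, wB2⟩ := main ((a.1 + b.1) / 2, (a.2 + b.2) / 2) hmid
  simp only at wmx wmv wB2
  have hub : ∀ t ∈ Set.Icc (0:ℝ) 1, a.2 / ε ^ p + t * (b.2 / ε ^ p - a.2 / ε ^ p)
      ≤ (a.1 + t * (b.1 - a.1)) ^ p := by
    intro t ht
    have e1 : a.2 / ε ^ p + t * (b.2 / ε ^ p - a.2 / ε ^ p)
      = (a.2 + t * (b.2 - a.2)) / ε ^ p := by ring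
    rw [e1, div_le_iff₀ hεp, mul_comm _ (ε ^ p)]
    exact (hsg t ht).2.2
  have hub' : ∀ t ∈ Set.Icc (0:ℝ) 1, b.2 / ε ^ p + t * (a.2 / ε ^ p - b.2 / ε ^ p)
      ≤ (b.1 + t * (a.1 - b.1)) ^ p := by
    intro t ht
    have := hub (1 - t) ⟨by linarith [ht.2], by linarith [ht.1]⟩
    convert this using 1
    · ring
    · congr 1; ring
  have sa : LPl p q a.1 (a.2 / ε ^ p) wa ≤ LPl p q a.1 (a.2 / ε ^ p) wm := by
    apply LPl_supp hp hq0 wa0 wax wav wm0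
    rcases le_or_gt wm a.1 with h | h
    · exact Or.inl h
    · refine Or.inr (tang wm0 wmx h ?_ hub)
      rw [← wmv]; ring
  have sb : LPl p q b.1 (b.2 / ε ^ p) wb ≤ LPl p q b.1 (b.2 / ε ^ p) wm := by
    apply LPl_supp hp hq0 wb0 wbx wbv wm0
    rcases le_or_gt wm b.1 with h | h
    · exact Or.inl h
    · refine Or.inr (tang wm0 (by linarith) h ?_ hub')
      rw [add_comm b.1, ← wmv]; ring
  have hlin : LPl p q ((a.1 + b.1) / 2) ((a.2 + b.2) / 2 / ε ^ p) wm
      = (LPl p q a.1 (a.2 / ε ^ p) wm + LPl p q b.1 (b.2 / ε ^ p) wm) / 2 := by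
    unfold LPl; ring
  have hpp : 0 < p * (p - 1) := mul_pos (by linarith) (by linarith)
  refine le_of_mul_le_mul_left ?_ hpp
  rw [wB2, hlin]
  have ta := mul_le_mul_of_nonneg_left sa hCpos.le
  have tb := mul_le_mul_of_nonneg_left sb hCpos.le
  linarith
end
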